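/- Let λ be a partition with at most n parts and μ ∈ S_n(λ). Then for every 1 ≤ i ≤ n−1: (1) if μ_i > μ_{i+1} then T_i f*_μ = f*_{s_i·μ}; (2) if μ_i = μ_{i+1} then T_i f*_μ = t f*_μ; (3) if μ_i < μ_{i+1} then T_i f*_μ = (t−1) f*_μ + t f*_{s_i·μ}. -/

import Mathlib

open MvPolynomial

noncomputable section
open scoped Classical

/-- The field `K = ℚ(q,t)`. -/
abbrev K : Type := FractionRing (MvPolynomial (Fin 2) ℚ)

/-- The indeterminate `q` as an element of `K`. -/
def qq : K := algebraMap (MvPolynomial (Fin 2) ℚ) K (X 0)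

/-- The indeterminate `t` as an element of `K`. -/
def tt : K := algebraMap (MvPolynomial (Fin 2) ℚ) K (X 1)

/-- The size `|ν|` of a composition. -/
def csize {n : ℕ} (ν : Fin n → ℕ) : ℕ := ∑ i, ν i

/-- `k_i(ν) = #{j < i : ν_j > ν_i} + #{j > i : ν_j ≥ ν_i}`. -/
def kstat {n : ℕ} (ν : Fin n → ℕ) (i : Fin n) : ℕ :=
  Set.ncard {j : Fin n | j < i ∧ ν i < ν j} + Set.ncard {j : Fin n | i < j ∧ ν i ≤ ν j}

/-- The evaluation point `ν̃ = (q^{ν_i} t^{-k_i(ν)})_i`. -/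
def evalPt {n : ℕ} (ν : Fin n → ℕ) : Fin n → K :=
  fun i => qq ^ ν i * tt ^ (-(kstat ν i : ℤ))

/-- Weakly decreasing composition. -/
def IsPartition {n : ℕ} (l : Fin n → ℕ) : Prop := ∀ i j : Fin n, i ≤ j → l j ≤ l i

/-- The action `σ·μ := μ ∘ σ⁻¹`. -/
def permAct {n : ℕ} (σ : Equiv.Perm (Fin n)) (μ : Fin n → ℕ) : Fin n → ℕ := μ ∘ ⇑σ.symm

/-- `S_n(λ)`: the rearrangements of `λ`. -/
def Sn {n : ℕ} (l : Fin n → ℕ) : Set (Fin n → ℕ) :=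
  {μ | ∃ σ : Equiv.Perm (Fin n), permAct σ l = μ}

/-- The rearrangements of `λ` as a `Finset`. -/
def SnFinset {n : ℕ} (l : Fin n → ℕ) : Finset (Fin n → ℕ) :=
  Finset.image (fun σ : Equiv.Perm (Fin n) => permAct σ l) Finset.univ

/-- The exponent `Finsupp` of the monomial `x^μ`. -/
def expOf {n : ℕ} (μ : Fin n → ℕ) : Fin n →₀ ℕ := Finsupp.equivFunOnFinite.symm μ

/-- Characterization of the interpolation nonsymmetric Macdonald polynomial `E*_μ`. -/
def IsEstar {n : ℕ} (μ : Fin n → ℕ) (f : MvPolynomial (Fin n) K) : Prop :=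
  f.totalDegree ≤ csize μ ∧ coeff (expOf μ) f = 1 ∧
    ∀ ν : Fin n → ℕ, csize ν ≤ csize μ → ν ≠ μ → eval (evalPt ν) f = 0

/-- The interpolation nonsymmetric Macdonald polynomial `E*_μ` (unique by Knop–Sahi). -/
def Estar {n : ℕ} (μ : Fin n → ℕ) : MvPolynomial (Fin n) K :=
  if h : ∃ f, IsEstar μ f then h.choose else 0

/-- Characterization of the interpolation (symmetric) Macdonald polynomial `P*_λ`. -/
def IsPstar {n : ℕ} (l : Fin n → ℕ) (f : MvPolynomial (Fin n) K) : Prop :=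
  f.IsSymmetric ∧ f.totalDegree ≤ csize l ∧ coeff (expOf l) f = 1 ∧
    ∀ ν : Fin n → ℕ, IsPartition ν → csize ν ≤ csize l → ν ≠ l → eval (evalPt ν) f = 0

/-- The interpolation Macdonald polynomial `P*_λ`. -/
def Pstar {n : ℕ} (l : Fin n → ℕ) : MvPolynomial (Fin n) K :=
  if h : ∃ f, IsPstar l f then h.choose else 0

/-- The space `V*_λ`. -/
def Vstar {n : ℕ} (l : Fin n → ℕ) : Submodule K (MvPolynomial (Fin n) K) :=
  (restrictTotalDegree (Fin n) K (csize l)) ⊓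
    ⨅ (ν : Fin n → ℕ) (_ : csize ν ≤ csize l ∧ ν ∉ Sn l),
      LinearMap.ker (aeval (R := K) (evalPt ν)).toLinearMap

/-- Exchange of the variables `x_i` and `x_j` in a polynomial. -/
def swapVars {n : ℕ} (i j : Fin n) (f : MvPolynomial (Fin n) K) : MvPolynomial (Fin n) K :=
  rename (Equiv.swap i j) f

/-- Exact division of polynomials: the unique `g` with `a = b * g` when it exists. -/
def exactDiv {n : ℕ} (a b : MvPolynomial (Fin n) K) : MvPolynomial (Fin n) K :=
  if h : ∃ g, a = b * g then h.choose else 0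

/-- The Hecke operator
`T f = t f − ((t x_i − x_j)/(x_i − x_j))·(f − s_i f)` (where `j = i+1`). -/
def hecke {n : ℕ} (i j : Fin n) (f : MvPolynomial (Fin n) K) : MvPolynomial (Fin n) K :=
  C tt * f - (C tt * X i - X j) * exactDiv (f - swapVars i j f) (X i - X j)

/-- The Coxeter length of a permutation (number of inversions). -/
def permLength {n : ℕ} (σ : Equiv.Perm (Fin n)) : ℕ :=
  Set.ncard {p : Fin n × Fin n | p.1 < p.2 ∧ σ p.2 < σ p.1}

/-- The adjacent transposition `s_i = (i, i+1)` (0-indexed). -/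
def adjSwap {n : ℕ} (i : {i : ℕ // i + 1 < n}) : Equiv.Perm (Fin n) :=
  Equiv.swap ⟨i.1, Nat.lt_of_succ_lt i.2⟩ ⟨i.1 + 1, i.2⟩

/-- The Hecke operator `T_i` for an adjacent transposition index. -/
def heckeAt {n : ℕ} (i : {i : ℕ // i + 1 < n}) :
    MvPolynomial (Fin n) K → MvPolynomial (Fin n) K :=
  hecke ⟨i.1, Nat.lt_of_succ_lt i.2⟩ ⟨i.1 + 1, i.2⟩

/-- `T_{i_1} ⋯ T_{i_ℓ} f` for a word `w = [i_1, …, i_ℓ]`. -/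
def Tword {n : ℕ} (w : List {i : ℕ // i + 1 < n}) (f : MvPolynomial (Fin n) K) :
    MvPolynomial (Fin n) K :=
  w.foldr heckeAt f

/-- `w` is a reduced word for `σ`. -/
def IsReducedWordOf {n : ℕ} (w : List {i : ℕ // i + 1 < n}) (σ : Equiv.Perm (Fin n)) : Prop :=
  (w.map adjSwap).prod = σ ∧ w.length = permLength σ

/-- `T_σ`, computed from a reduced word of `σ` (independent of the choice, by the
Hecke algebra relations). -/
def Tsigma {n : ℕ} (σ : Equiv.Perm (Fin n)) :
    MvPolynomial (Fin n) K → MvPolynomial (Fin n) K :=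
  if h : ∃ w, IsReducedWordOf w σ then Tword h.choose else id

/-- `σ_μ`: the (unique) shortest permutation with `σ·l = μ`. -/
def sigmaMin {n : ℕ} (l μ : Fin n → ℕ) : Equiv.Perm (Fin n) :=
  if h : ∃ σ, permAct σ l = μ ∧ ∀ τ, permAct τ l = μ → permLength σ ≤ permLength τ then
    h.choose else 1

/-- The weakly decreasing rearrangement of a composition. -/
def sortDesc {n : ℕ} (μ : Fin n → ℕ) : Fin n → ℕ :=
  if h : ∃ l, IsPartition l ∧ μ ∈ Sn l then h.choose else μ

/-- The interpolation ASEP polynomial `f*_μ = T_{σ_μ} E*_λ`, where `λ` is the weakly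
decreasing rearrangement of `μ`. -/
def fstar {n : ℕ} (μ : Fin n → ℕ) : MvPolynomial (Fin n) K :=
  Tsigma (sigmaMin (sortDesc μ) μ) (Estar (sortDesc μ))

/-- The composition with entries `i` and `j` exchanged. -/
def swapEntries {n : ℕ} (i j : Fin n) (μ : Fin n → ℕ) : Fin n → ℕ := μ ∘ ⇑(Equiv.swap i j)
/-! ### Hecke operators -/

theorem swap_sub_dvd {n : ℕ} (i j : Fin n) (f : MvPolynomial (Fin n) K) :
    ∃ g, f - swapVars i j f = (X i - X j) * g := by
  unfold swapVars
  induction f using MvPolynomial.induction_on with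
  | C a => exact ⟨0, by simp⟩
  | add p q hp hq =>
    obtain ⟨g, hg⟩ := hp
    obtain ⟨h, hh⟩ := hq
    refine ⟨g + h, ?_⟩
    rw [map_add, mul_add, ← hg, ← hh]; ring
  | mul_X p k hp =>
    obtain ⟨g, hg⟩ := hp
    have hk : ∃ e : MvPolynomial (Fin n) K, X k - X (Equiv.swap i j k) = (X i - X j) * e := by
      by_cases h1 : k = i
      · subst h1; exact ⟨1, by simp⟩
      · by_cases h2 : k = j
        · subst h2; exact ⟨-1, by rw [Equiv.swap_apply_right]; ring⟩
        · rw [Equiv.swap_apply_of_ne_of_ne h1 h2]; exact ⟨0, by simp⟩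
    obtain ⟨e, he⟩ := hk
    refine ⟨g * X k + rename (Equiv.swap i j) p * e, ?_⟩
    rw [map_mul, rename_X]
    linear_combination X k * hg + rename (Equiv.swap i j) p * he

theorem exactDiv_spec {n : ℕ} (i j : Fin n) (f : MvPolynomial (Fin n) K) :
    f - swapVars i j f = (X i - X j) * exactDiv (f - swapVars i j f) (X i - X j) := by
  have h := swap_sub_dvd i j f
  unfold exactDiv
  rw [dif_pos h]
  exact h.choose_spec

theorem X_sub_X_ne {n : ℕ} {i j : Fin n} (h : i ≠ j) :
    (X i - X j : MvPolynomial (Fin n) K) ≠ 0 :=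
  fun h' => h (X_injective (sub_eq_zero.mp h'))

theorem hecke_spec {n : ℕ} (i j : Fin n) (f : MvPolynomial (Fin n) K) :
    (X i - X j) * hecke i j f =
      (1 - C tt) * X j * f + (C tt * X i - X j) * swapVars i j f := by
  have h := exactDiv_spec i j f
  unfold hecke
  linear_combination (C tt * X i - X j) * h

theorem swapVars_add {n : ℕ} (i j : Fin n) (f g : MvPolynomial (Fin n) K) :
    swapVars i j (f + g) = swapVars i j f + swapVars i j g := map_add _ _ _
theorem swapVars_sub {n : ℕ} (i j : Fin n) (f g : MvPolynomial (Fin n) K) :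
    swapVars i j (f - g) = swapVars i j f - swapVars i j g := map_sub _ _ _
theorem swapVars_mul {n : ℕ} (i j : Fin n) (f g : MvPolynomial (Fin n) K) :
    swapVars i j (f * g) = swapVars i j f * swapVars i j g := map_mul _ _ _
theorem swapVars_one {n : ℕ} (i j : Fin n) :
    swapVars i j (1 : MvPolynomial (Fin n) K) = 1 := map_one _
theorem swapVars_C {n : ℕ} (i j : Fin n) (a : K) :
    swapVars i j (C a : MvPolynomial (Fin n) K) = C a := rename_C _ _
theorem swapVars_X {n : ℕ} (i j k : Fin n) :
    swapVars i j (X k : MvPolynomial (Fin n) K) = X (Equiv.swap i j k) := rename_X _ _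
theorem swapVars_swapVars {n : ℕ} (i j : Fin n) (f : MvPolynomial (Fin n) K) :
    swapVars i j (swapVars i j f) = f := by
  unfold swapVars
  rw [rename_rename]
  have : (⇑(Equiv.swap i j) ∘ ⇑(Equiv.swap i j)) = id := by ext; simp
  rw [this, rename_id]; rfl

/-- `hecke` commutes with scalars. -/
theorem hecke_smul {n : ℕ} {i j : Fin n} (h : i ≠ j) (a : K) (f : MvPolynomial (Fin n) K) :
    hecke i j (C a * f) = C a * hecke i j f := by
  apply mul_left_cancel₀ (X_sub_X_ne h)
  have h1 := hecke_spec i j (C a * f)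
  have h2 := hecke_spec i j f
  rw [swapVars_mul, swapVars_C] at h1
  rw [h1]
  linear_combination - C a * h2

theorem field_quad {F : Type*} [Field F] (t a b f sf g sg h : F) (hab : a - b ≠ 0)
    (h1 : (a - b) * g = (1 - t) * b * f + (t * a - b) * sf)
    (h2 : (b - a) * sg = (1 - t) * a * sf + (t * b - a) * f)
    (h3 : (a - b) * h = (1 - t) * b * g + (t * a - b) * sg) :
    h = (t - 1) * g + t * f := by
  have hba : b - a ≠ 0 := fun h => hab (by linear_combination -h)
  apply mul_left_cancel₀ (mul_ne_zero hab hab)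
  linear_combination (a - b) * h3 + ((1 - t) * b - (t - 1) * (a - b)) * h1 - (t * a - b) * h2

theorem field_braid {F : Type*} [Field F] (t a b c f f1 f2 f12 f21 f121 : F)
    (g g1 g2 g12 h h1 p g' g1' g2' g21' h' h2' p' : F)
    (hab : a - b ≠ 0) (hac : a - c ≠ 0) (hbc : b - c ≠ 0)
    (e1 : (a - b) * g = (1 - t) * b * f + (t * a - b) * f1)
    (e2 : (b - a) * g1 = (1 - t) * a * f1 + (t * b - a) * f)
    (e3 : (a - c) * g2 = (1 - t) * c * f2 + (t * a - c) * f21)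
    (e4 : (b - c) * g12 = (1 - t) * c * f12 + (t * b - c) * f121)
    (e5 : (b - c) * h = (1 - t) * c * g + (t * b - c) * g2)
    (e6 : (a - c) * h1 = (1 - t) * c * g1 + (t * a - c) * g12)
    (e7 : (a - b) * p = (1 - t) * b * h + (t * a - b) * h1)
    (d1 : (b - c) * g' = (1 - t) * c * f + (t * b - c) * f2)
    (d2 : (c - b) * g2' = (1 - t) * b * f2 + (t * c - b) * f)
    (d3 : (a - c) * g1' = (1 - t) * c * f1 + (t * a - c) * f12)
    (d4 : (a - b) * g21' = (1 - t) * b * f21 + (t * a - b) * f121)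
    (d5 : (a - b) * h' = (1 - t) * b * g' + (t * a - b) * g1')
    (d6 : (a - c) * h2' = (1 - t) * c * g2' + (t * a - c) * g21')
    (d7 : (b - c) * p' = (1 - t) * c * h' + (t * b - c) * h2') :
    p = p' := by
  have hba : b - a ≠ 0 := fun h => hab (by linear_combination -h)
  have hcb : c - b ≠ 0 := fun h => hbc (by linear_combination -h)
  have e2' : (a - b) * g1 = - ((1 - t) * a * f1 + (t * b - a) * f) := by
    linear_combination - e2
  have d2' : (b - c) * g2' = - ((1 - t) * b * f2 + (t * c - b) * f) := by
    linear_combination - d2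
  rw [mul_comm, ← eq_div_iff hab] at e1 e2' e7 d4 d5
  rw [mul_comm, ← eq_div_iff hac] at e3 e6 d3 d6
  rw [mul_comm, ← eq_div_iff hbc] at e4 e5 d1 d2' d7
  subst e1 e2' d4 e3 d3 e4 d1 d2'
  subst e5 e6 d5 d6
  subst e7 d7
  field_simp
  ring

theorem field_comm {F : Type*} [Field F] (t a b c d f f1 f2 f12 : F)
    (g g2 h g' g1' h' : F)
    (hab : a - b ≠ 0) (hcd : c - d ≠ 0)
    (e1 : (a - b) * g = (1 - t) * b * f + (t * a - b) * f1)
    (e2 : (a - b) * g2 = (1 - t) * b * f2 + (t * a - b) * f12)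
    (e3 : (c - d) * h = (1 - t) * d * g + (t * c - d) * g2)
    (d1 : (c - d) * g' = (1 - t) * d * f + (t * c - d) * f2)
    (d2 : (c - d) * g1' = (1 - t) * d * f1 + (t * c - d) * f12)
    (d3 : (a - b) * h' = (1 - t) * b * g' + (t * a - b) * g1') :
    h = h' := by
  apply mul_left_cancel₀ (mul_ne_zero hab hcd)
  linear_combination (a - b) * e3 - (c - d) * d3 + (1 - t) * d * e1 + (t * c - d) * e2
    - (1 - t) * b * d1 - (t * a - b) * d2

/-- The embedding into the fraction field. -/
def toFrac (n : ℕ) : MvPolynomial (Fin n) K →+* FractionRing (MvPolynomial (Fin n) K) :=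
  algebraMap _ _

theorem toFrac_inj (n : ℕ) : Function.Injective (toFrac n) :=
  IsFractionRing.injective _ _

theorem toFrac_ne {n : ℕ} {i j : Fin n} (h : i ≠ j) :
    toFrac n (X i) - toFrac n (X j) ≠ 0 := by
  rw [← map_sub]
  exact fun h' => X_sub_X_ne h (toFrac_inj n (by rw [h', map_zero]))

/-- A transported version of `hecke_spec`. -/
theorem toFrac_rel {n : ℕ} {x y : MvPolynomial (Fin n) K} {g f sf : MvPolynomial (Fin n) K}
    (h : (x - y) * g = (1 - C tt) * y * f + (C tt * x - y) * sf) :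
    (toFrac n x - toFrac n y) * toFrac n g =
      (1 - toFrac n (C tt)) * toFrac n y * toFrac n f +
        (toFrac n (C tt) * toFrac n x - toFrac n y) * toFrac n sf := by
  have := congrArg (toFrac n) h
  simpa only [map_mul, map_sub, map_add, map_one] using this

theorem rel_swap {n : ℕ} {k l x y : Fin n} {g f sf : MvPolynomial (Fin n) K}
    (h : (X x - X y) * g = (1 - C tt) * X y * f + (C tt * X x - X y) * sf) :
    (X (Equiv.swap k l x) - X (Equiv.swap k l y)) * swapVars k l g =
      (1 - C tt) * X (Equiv.swap k l y) * swapVars k l f +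
        (C tt * X (Equiv.swap k l x) - X (Equiv.swap k l y)) * swapVars k l sf := by
  have := congrArg (swapVars k l) h
  simpa only [swapVars_mul, swapVars_sub, swapVars_add, swapVars_one, swapVars_C, swapVars_X]
    using this

theorem hecke_quad {n : ℕ} {i j : Fin n} (hij : i ≠ j) (f : MvPolynomial (Fin n) K) :
    hecke i j (hecke i j f) = C (tt - 1) * hecke i j f + C tt * f := by
  have h1 := hecke_spec i j f
  have h2 := rel_swap (k := i) (l := j) h1
  have h3 := hecke_spec i j (hecke i j f)
  rw [swapVars_swapVars, Equiv.swap_apply_left, Equiv.swap_apply_right] at h2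
  apply toFrac_inj n
  have := field_quad _ _ _ _ _ _ _ _ (toFrac_ne hij) (toFrac_rel h1) (toFrac_rel h2)
    (toFrac_rel h3)
  rw [this]
  simp only [map_mul, map_sub, map_add, map_one]

theorem hecke_braid {n : ℕ} {i j k : Fin n} (hij : i ≠ j) (hik : i ≠ k) (hjk : j ≠ k)
    (f : MvPolynomial (Fin n) K) :
    hecke i j (hecke j k (hecke i j f)) = hecke j k (hecke i j (hecke j k f)) := by
  have hb : swapVars i j (swapVars j k (swapVars i j f)) =
      swapVars j k (swapVars i j (swapVars j k f)) := by
    unfold swapVars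
    simp only [rename_rename]
    congr 2
    ext x
    simp only [Function.comp_apply, Equiv.swap_apply_def]
    split_ifs <;> simp_all
  have s1 : Equiv.swap i j k = k := Equiv.swap_apply_of_ne_of_ne hik.symm hjk.symm
  have s2 : Equiv.swap j k i = i := Equiv.swap_apply_of_ne_of_ne hij hik
  have e1 := hecke_spec i j f
  have e2 := rel_swap (k := i) (l := j) e1
  have e3 := rel_swap (k := j) (l := k) e1
  have e4 := rel_swap (k := i) (l := j) e3
  have e5 := hecke_spec j k (hecke i j f)
  have e6 := rel_swap (k := i) (l := j) e5
  have e7 := hecke_spec i j (hecke j k (hecke i j f))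
  have d1 := hecke_spec j k f
  have d2 := rel_swap (k := j) (l := k) d1
  have d3 := rel_swap (k := i) (l := j) d1
  have d4 := rel_swap (k := j) (l := k) d3
  have d5 := hecke_spec i j (hecke j k f)
  have d6 := rel_swap (k := j) (l := k) d5
  have d7 := hecke_spec j k (hecke i j (hecke j k f))
  rw [← hb] at d4
  simp only [swapVars_swapVars, Equiv.swap_apply_left, Equiv.swap_apply_right, s1, s2] at *
  apply toFrac_inj n
  exact field_braid _ _ _ _ _ _ _ _ _ _ _ _ _ _ _ _ _ _ _ _ _ _ _ _
    (toFrac_ne hij) (toFrac_ne hik) (toFrac_ne hjk)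
    (toFrac_rel e1) (toFrac_rel e2) (toFrac_rel e3) (toFrac_rel e4) (toFrac_rel e5)
    (toFrac_rel e6) (toFrac_rel e7)
    (toFrac_rel d1) (toFrac_rel d2) (toFrac_rel d3) (toFrac_rel d4) (toFrac_rel d5)
    (toFrac_rel d6) (toFrac_rel d7)

theorem hecke_comm {n : ℕ} {i j k l : Fin n} (hij : i ≠ j) (hkl : k ≠ l) (hik : i ≠ k)
    (hil : i ≠ l) (hjk : j ≠ k) (hjl : j ≠ l) (f : MvPolynomial (Fin n) K) :
    hecke k l (hecke i j f) = hecke i j (hecke k l f) := by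
  have hb : swapVars k l (swapVars i j f) = swapVars i j (swapVars k l f) := by
    unfold swapVars
    simp only [rename_rename]
    congr 2
    ext x
    simp only [Function.comp_apply, Equiv.swap_apply_def]
    split_ifs <;> simp_all
  have s1 : Equiv.swap i j k = k := Equiv.swap_apply_of_ne_of_ne hik.symm hjk.symm
  have s2 : Equiv.swap i j l = l := Equiv.swap_apply_of_ne_of_ne hil.symm hjl.symm
  have s3 : Equiv.swap k l i = i := Equiv.swap_apply_of_ne_of_ne hik hil
  have s4 : Equiv.swap k l j = j := Equiv.swap_apply_of_ne_of_ne hjk hjl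
  have e1 := hecke_spec i j f
  have e2 := rel_swap (k := k) (l := l) e1
  have e3 := hecke_spec k l (hecke i j f)
  have d1 := hecke_spec k l f
  have d2 := rel_swap (k := i) (l := j) d1
  have d3 := hecke_spec i j (hecke k l f)
  rw [hb] at e2
  simp only [s1, s2, s3, s4] at *
  apply toFrac_inj n
  exact field_comm _ _ _ _ _ _ _ _ _ _ _ _ _ _ _ (toFrac_ne hij) (toFrac_ne hkl)
    (toFrac_rel e1) (toFrac_rel e2) (toFrac_rel e3)
    (toFrac_rel d1) (toFrac_rel d2) (toFrac_rel d3)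

/-! ### Permutations and reduced words -/

theorem swap_lt_swap {n : ℕ} {i j : Fin n} (hij : (j : ℕ) = (i : ℕ) + 1) {x y : Fin n}
    (hxy : x < y) (hne : ¬ (x = i ∧ y = j)) : Equiv.swap i j x < Equiv.swap i j y := by
  simp only [Equiv.swap_apply_def, Fin.lt_def, Fin.ext_iff] at *
  split_ifs <;> omega

theorem permLength_swap_mul {n : ℕ} {i j : Fin n} (hij : (j : ℕ) = (i : ℕ) + 1)
    (σ : Equiv.Perm (Fin n)) (h : σ.symm i < σ.symm j) :
    permLength (Equiv.swap i j * σ) = permLength σ + 1 := by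
  unfold permLength
  rw [← Set.ncard_insert_of_notMem (a := (σ.symm i, σ.symm j)) _ (Set.toFinite _)]
  · congr 1
    ext ⟨x, y⟩
    simp only [Set.mem_ofPred_eq, Set.mem_insert_iff, Prod.mk.injEq, Equiv.Perm.mul_apply,
      Equiv.eq_symm_apply]
    constructor
    · rintro ⟨h1, h2⟩
      by_cases hc : σ x = i ∧ σ y = j
      · exact Or.inl hc
      · refine Or.inr ⟨h1, ?_⟩
        by_contra h3
        have h4 : σ x < σ y := lt_of_le_of_ne (not_lt.mp h3) (fun h => h1.ne (σ.injective h))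
        exact lt_asymm h2 (swap_lt_swap hij h4 hc)
    · rintro (⟨h1, h2⟩ | ⟨h1, h2⟩)
      · subst h1 h2
        simp only [Equiv.symm_apply_apply] at h
        refine ⟨h, ?_⟩
        rw [Equiv.swap_apply_left, Equiv.swap_apply_right, Fin.lt_def]
        omega
      · refine ⟨h1, swap_lt_swap hij h2 ?_⟩
        rintro ⟨h3, h4⟩
        rw [← h3, ← h4] at h
        simp only [Equiv.symm_apply_apply] at h
        exact lt_asymm h h1
  · simp only [Set.mem_ofPred_eq, Equiv.apply_symm_apply, not_and, not_lt]
    intro _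
    rw [Fin.le_def]; omega

theorem permLength_swap_mul' {n : ℕ} {i j : Fin n} (hij : (j : ℕ) = (i : ℕ) + 1)
    (σ : Equiv.Perm (Fin n)) (h : σ.symm j < σ.symm i) :
    permLength (Equiv.swap i j * σ) + 1 = permLength σ := by
  have := permLength_swap_mul hij (Equiv.swap i j * σ) (by
    have e : ∀ x, (Equiv.swap i j * σ).symm x = σ.symm (Equiv.swap i j x) := by
      intro x
      rw [Equiv.symm_apply_eq, Equiv.Perm.mul_apply, Equiv.apply_symm_apply, Equiv.swap_apply_self]
    rw [e, e, Equiv.swap_apply_left, Equiv.swap_apply_right]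
    exact h)
  rw [← mul_assoc, Equiv.swap_mul_self, one_mul] at this
  exact this.symm

theorem permLength_inv {n : ℕ} (σ : Equiv.Perm (Fin n)) : permLength σ⁻¹ = permLength σ := by
  unfold permLength
  refine (Set.ncard_congr (fun p _ => (σ p.2, σ p.1)) ?_ ?_ ?_).symm
  · rintro ⟨x, y⟩ ⟨h1, h2⟩
    exact ⟨h2, by simpa using h1⟩
  · rintro ⟨x, y⟩ ⟨x', y'⟩ _ _ h
    simp only [Prod.mk.injEq, EmbeddingLike.apply_eq_iff_eq] at h
    rw [h.1, h.2]
  · rintro ⟨x, y⟩ ⟨h1, h2⟩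
    exact ⟨(σ⁻¹ y, σ⁻¹ x), ⟨h2, by simpa using h1⟩, by simp⟩

/-- First index of the adjacent pair. -/
abbrev lo {n : ℕ} (i : {i : ℕ // i + 1 < n}) : Fin n := ⟨i.1, Nat.lt_of_succ_lt i.2⟩
/-- Second index of the adjacent pair. -/
abbrev hi {n : ℕ} (i : {i : ℕ // i + 1 < n}) : Fin n := ⟨i.1 + 1, i.2⟩

/-- Left descents. -/
def IsDesc {n : ℕ} (i : {i : ℕ // i + 1 < n}) (σ : Equiv.Perm (Fin n)) : Prop :=
  σ.symm (hi i) < σ.symm (lo i)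

theorem not_isDesc {n : ℕ} {i : {i : ℕ // i + 1 < n}} {σ : Equiv.Perm (Fin n)}
    (h : ¬ IsDesc i σ) : σ.symm (lo i) < σ.symm (hi i) := by
  refine lt_of_le_of_ne (not_lt.mp h) (fun h' => ?_)
  have := σ.symm.injective h'
  simp [Fin.ext_iff] at this

theorem len_desc {n : ℕ} {i : {i : ℕ // i + 1 < n}} {σ : Equiv.Perm (Fin n)}
    (h : IsDesc i σ) : permLength (adjSwap i * σ) + 1 = permLength σ :=
  permLength_swap_mul' (i := lo i) (j := hi i) rfl σ h

theorem len_not_desc {n : ℕ} {i : {i : ℕ // i + 1 < n}} {σ : Equiv.Perm (Fin n)}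
    (h : ¬ IsDesc i σ) : permLength (adjSwap i * σ) = permLength σ + 1 :=
  permLength_swap_mul (i := lo i) (j := hi i) rfl σ (not_isDesc h)

theorem adjSwap_mul_self {n : ℕ} (i : {i : ℕ // i + 1 < n}) : adjSwap i * adjSwap i = 1 :=
  Equiv.swap_mul_self _ _

theorem permLength_one {n : ℕ} : permLength (1 : Equiv.Perm (Fin n)) = 0 := by
  unfold permLength
  rw [Set.ncard_eq_zero (Set.toFinite _)]
  ext ⟨x, y⟩
  simp only [Set.mem_ofPred_eq, Equiv.Perm.one_apply, Set.mem_empty_iff_false, iff_false]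
  rintro ⟨h1, h2⟩
  exact lt_asymm h1 h2

theorem permLength_word_le {n : ℕ} (w : List {i : ℕ // i + 1 < n}) :
    permLength (w.map adjSwap).prod ≤ w.length := by
  induction w with
  | nil => simp [permLength_one]
  | cons i w ih =>
    rw [List.map_cons, List.prod_cons, List.length_cons]
    by_cases h : IsDesc i (w.map adjSwap).prod
    · have := len_desc h
      omega
    · have := len_not_desc h
      omega

theorem reduced_cons {n : ℕ} {i : {i : ℕ // i + 1 < n}} {σ : Equiv.Perm (Fin n)}
    {u : List {i : ℕ // i + 1 < n}} (h : IsDesc i σ) (hu : IsReducedWordOf u (adjSwap i * σ)) :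
    IsReducedWordOf (i :: u) σ := by
  refine ⟨?_, ?_⟩
  · rw [List.map_cons, List.prod_cons, hu.1, ← mul_assoc, adjSwap_mul_self, one_mul]
  · rw [List.length_cons, hu.2, len_desc h]

theorem reduced_tail {n : ℕ} {i : {i : ℕ // i + 1 < n}} {σ : Equiv.Perm (Fin n)}
    {u : List {i : ℕ // i + 1 < n}} (h : IsReducedWordOf (i :: u) σ) :
    IsDesc i σ ∧ IsReducedWordOf u (adjSwap i * σ) := by
  obtain ⟨h1, h2⟩ := h
  rw [List.map_cons, List.prod_cons] at h1
  rw [List.length_cons] at h2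
  have h3 : (u.map adjSwap).prod = adjSwap i * σ := by
    rw [← h1, ← mul_assoc, adjSwap_mul_self, one_mul]
  have h4 := permLength_word_le u
  rw [h3] at h4
  have h5 : IsDesc i σ := by
    by_contra h
    have := len_not_desc h
    omega
  refine ⟨h5, h3, ?_⟩
  have := len_desc h5
  omega

theorem perm_eq_one_of_no_desc {n : ℕ} {σ : Equiv.Perm (Fin n)}
    (h : ∀ i, ¬ IsDesc i σ) : σ = 1 := by
  have hs : StrictMono σ.symm := by
    cases n with
    | zero => intro x; exact x.elim0
    | succ m =>
      rw [Fin.strictMono_iff_lt_succ]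
      intro i
      exact not_isDesc (h ⟨i.1, by omega⟩)
  have := hs.eq_id
  ext x
  have h2 := congrFun this (σ x)
  simp only [Equiv.symm_apply_apply, id_eq] at h2
  rw [← h2]; rfl

theorem exists_reduced {n : ℕ} (σ : Equiv.Perm (Fin n)) : ∃ w, IsReducedWordOf w σ := by
  induction hl : permLength σ using Nat.strong_induction_on generalizing σ with
  | _ m ih =>
    by_cases h : ∃ i, IsDesc i σ
    · obtain ⟨i, hi⟩ := h
      have := len_desc hi
      obtain ⟨u, hu⟩ := ih _ (by omega) (adjSwap i * σ) rfl
      exact ⟨i :: u, reduced_cons hi hu⟩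
    · push Not at h
      have := perm_eq_one_of_no_desc h
      subst this
      exact ⟨[], by simp, by simp [permLength_one]⟩

theorem symm_adjSwap_mul {n : ℕ} (i : {i : ℕ // i + 1 < n}) (σ : Equiv.Perm (Fin n)) (x : Fin n) :
    (adjSwap i * σ).symm x = σ.symm (adjSwap i x) := by
  rw [Equiv.symm_apply_eq, Equiv.Perm.mul_apply, Equiv.apply_symm_apply]
  unfold adjSwap
  rw [Equiv.swap_apply_self]

theorem perm_swap_comm {n : ℕ} {i j k l : Fin n} (hij : i ≠ j) (hkl : k ≠ l) (hik : i ≠ k)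
    (hil : i ≠ l) (hjk : j ≠ k) (hjl : j ≠ l) :
    Equiv.swap i j * Equiv.swap k l = Equiv.swap k l * Equiv.swap i j := by
  refine Equiv.ext fun x => ?_
  simp only [Equiv.Perm.mul_apply, Equiv.swap_apply_def]
  split_ifs <;> simp_all

theorem perm_swap_braid {n : ℕ} {i j k : Fin n} (hij : i ≠ j) (hik : i ≠ k) (hjk : j ≠ k) :
    Equiv.swap i j * Equiv.swap j k * Equiv.swap i j =
      Equiv.swap j k * Equiv.swap i j * Equiv.swap j k := by
  refine Equiv.ext fun x => ?_
  simp only [Equiv.Perm.mul_apply, Equiv.swap_apply_def]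
  split_ifs <;> simp_all

/-- Far case: disjoint descents. -/
theorem far_case {n : ℕ} {i j : {i : ℕ // i + 1 < n}} {σ : Equiv.Perm (Fin n)}
    (hij : i.1 + 1 < j.1 ∨ j.1 + 1 < i.1) (hj : IsDesc j σ) :
    IsDesc j (adjSwap i * σ) ∧ adjSwap i * (adjSwap j * σ) = adjSwap j * (adjSwap i * σ) := by
  constructor
  · unfold IsDesc
    rw [symm_adjSwap_mul, symm_adjSwap_mul]
    unfold adjSwap
    rw [Equiv.swap_apply_of_ne_of_ne, Equiv.swap_apply_of_ne_of_ne]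
    · exact hj
    all_goals
      simp only [ne_eq, Fin.ext_iff]
      omega
  · rw [← mul_assoc, ← mul_assoc]
    congr 1
    apply perm_swap_comm <;> simp only [ne_eq, Fin.ext_iff] <;> omega

theorem near_case {n : ℕ} {i j : {i : ℕ // i + 1 < n}} {σ : Equiv.Perm (Fin n)}
    (hij : i.1 + 1 = j.1) (di : IsDesc i σ) (dj : IsDesc j σ) :
    IsDesc j (adjSwap i * σ) ∧ IsDesc i (adjSwap j * (adjSwap i * σ)) ∧
    IsDesc i (adjSwap j * σ) ∧ IsDesc j (adjSwap i * (adjSwap j * σ)) ∧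
    adjSwap i * (adjSwap j * (adjSwap i * σ)) = adjSwap j * (adjSwap i * (adjSwap j * σ)) := by
  obtain ⟨i, hi'⟩ := i
  obtain ⟨j, hj'⟩ := j
  simp only at hij
  subst hij
  have a1 : adjSwap ⟨i, hi'⟩ ⟨i, by omega⟩ = ⟨i + 1, by omega⟩ := by simp [adjSwap]
  have a2 : adjSwap ⟨i, hi'⟩ ⟨i + 1, by omega⟩ = ⟨i, by omega⟩ := by simp [adjSwap]
  have a3 : adjSwap ⟨i, hi'⟩ ⟨i + 1 + 1, by omega⟩ = ⟨i + 1 + 1, by omega⟩ :=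
    Equiv.swap_apply_of_ne_of_ne (by simp only [ne_eq, Fin.ext_iff]; omega)
      (by simp only [ne_eq, Fin.ext_iff]; omega)
  have b1 : adjSwap ⟨i + 1, hj'⟩ ⟨i, by omega⟩ = ⟨i, by omega⟩ :=
    Equiv.swap_apply_of_ne_of_ne (by simp only [ne_eq, Fin.ext_iff]; omega)
      (by simp only [ne_eq, Fin.ext_iff]; omega)
  have b2 : adjSwap ⟨i + 1, hj'⟩ ⟨i + 1, by omega⟩ = ⟨i + 1 + 1, by omega⟩ := by simp [adjSwap]
  have b3 : adjSwap ⟨i + 1, hj'⟩ ⟨i + 1 + 1, by omega⟩ = ⟨i + 1, by omega⟩ := by simp [adjSwap]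
  unfold IsDesc lo hi at *
  simp only [symm_adjSwap_mul, a1, a2, a3, b1, b2, b3] at *
  refine ⟨dj.trans di, dj, dj.trans di, di, ?_⟩
  simp only [← mul_assoc]
  congr 1
  apply perm_swap_braid <;> simp only [ne_eq, Fin.ext_iff] <;> omega

theorem heckeAt_comm {n : ℕ} {i j : {i : ℕ // i + 1 < n}}
    (hij : i.1 + 1 < j.1 ∨ j.1 + 1 < i.1) (f : MvPolynomial (Fin n) K) :
    heckeAt i (heckeAt j f) = heckeAt j (heckeAt i f) := by
  unfold heckeAt
  apply hecke_comm <;> simp only [ne_eq, Fin.ext_iff] <;> omega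

theorem heckeAt_braid {n : ℕ} {i j : {i : ℕ // i + 1 < n}}
    (hij : i.1 + 1 = j.1) (f : MvPolynomial (Fin n) K) :
    heckeAt i (heckeAt j (heckeAt i f)) = heckeAt j (heckeAt i (heckeAt j f)) := by
  obtain ⟨i, hi'⟩ := i
  obtain ⟨j, hj'⟩ := j
  simp only at hij
  subst hij
  unfold heckeAt
  apply hecke_braid <;> simp only [ne_eq, Fin.ext_iff] <;> omega

/-- Matsumoto: `T_σ` does not depend on the reduced word. -/
theorem Tword_eq {n : ℕ} (f : MvPolynomial (Fin n) K) (σ : Equiv.Perm (Fin n))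
    (w w' : List {i : ℕ // i + 1 < n}) (h : IsReducedWordOf w σ) (h' : IsReducedWordOf w' σ) :
    Tword w f = Tword w' f := by
  induction hl : permLength σ using Nat.strong_induction_on generalizing σ w w' with
  | _ m ih =>
    have hlen : w.length = w'.length := h.2.trans h'.2.symm
    match w, w', hlen, h, h' with
    | [], [], _, _, _ => rfl
    | i :: w, j :: w', _, h, h' =>
      obtain ⟨di, ri⟩ := reduced_tail h
      obtain ⟨dj, rj⟩ := reduced_tail h'
      have li := len_desc di
      have lj := len_desc dj
      change heckeAt i (Tword w f) = heckeAt j (Tword w' f)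
      have near : ∀ i j : {i : ℕ // i + 1 < n}, i.1 + 1 = j.1 → ∀ w w',
          IsDesc i σ → IsDesc j σ → IsReducedWordOf w (adjSwap i * σ) →
          IsReducedWordOf w' (adjSwap j * σ) → heckeAt i (Tword w f) = heckeAt j (Tword w' f) := by
        intro i j hij w w' di dj ri rj
        have li := len_desc di
        have lj := len_desc dj
        obtain ⟨n1, n2, n3, n4, n5⟩ := near_case hij di dj
        obtain ⟨u, hu⟩ := exists_reduced (adjSwap i * (adjSwap j * (adjSwap i * σ)))
        have r1 := reduced_cons n1 (reduced_cons n2 hu)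
        have r2 := reduced_cons n3 (reduced_cons n4 (n5 ▸ hu))
        rw [ih _ (by omega) _ w _ ri r1 rfl, ih _ (by omega) _ w' _ rj r2 rfl]
        exact heckeAt_braid hij _
      rcases lt_trichotomy (i.1 + 1) j.1 with hlt | heq | hgt
      · obtain ⟨n1, n2⟩ := far_case (Or.inl hlt) dj
        obtain ⟨n3, _⟩ := far_case (Or.inr hlt) di
        obtain ⟨u, hu⟩ := exists_reduced (adjSwap i * (adjSwap j * σ))
        have r1 := reduced_cons n1 (n2 ▸ hu)
        have r2 := reduced_cons n3 hu
        rw [ih _ (by omega) _ w _ ri r1 rfl, ih _ (by omega) _ w' _ rj r2 rfl]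
        exact heckeAt_comm (Or.inl hlt) _
      · exact near i j heq w w' di dj ri rj
      · rcases lt_trichotomy (j.1 + 1) i.1 with hlt | heq | hgt'
        · obtain ⟨n1, n2⟩ := far_case (Or.inr hlt) dj
          obtain ⟨n3, _⟩ := far_case (Or.inl hlt) di
          obtain ⟨u, hu⟩ := exists_reduced (adjSwap i * (adjSwap j * σ))
          have r1 := reduced_cons n1 (n2 ▸ hu)
          have r2 := reduced_cons n3 hu
          rw [ih _ (by omega) _ w _ ri r1 rfl, ih _ (by omega) _ w' _ rj r2 rfl]
          exact heckeAt_comm (Or.inr hlt) _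
        · exact (near j i heq w' w dj di rj ri).symm
        · have : i = j := Subtype.ext (by omega)
          subst this
          rw [ih _ (by omega) _ w w' ri rj rfl]

theorem Tsigma_eq {n : ℕ} {σ : Equiv.Perm (Fin n)} {w : List {i : ℕ // i + 1 < n}}
    (h : IsReducedWordOf w σ) (f : MvPolynomial (Fin n) K) : Tsigma σ f = Tword w f := by
  have he : ∃ w, IsReducedWordOf w σ := ⟨w, h⟩
  unfold Tsigma
  rw [dif_pos he]
  exact Tword_eq f σ _ _ he.choose_spec h

theorem Tsigma_left {n : ℕ} (i : {i : ℕ // i + 1 < n}) {σ : Equiv.Perm (Fin n)}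
    (h : permLength (adjSwap i * σ) = permLength σ + 1) (f : MvPolynomial (Fin n) K) :
    Tsigma (adjSwap i * σ) f = heckeAt i (Tsigma σ f) := by
  obtain ⟨w, hw⟩ := exists_reduced σ
  rw [Tsigma_eq hw, Tsigma_eq (w := i :: w)]
  · rfl
  · exact ⟨by rw [List.map_cons, List.prod_cons, hw.1], by rw [List.length_cons, hw.2, h]⟩

theorem Tsigma_right {n : ℕ} (i : {i : ℕ // i + 1 < n}) {σ : Equiv.Perm (Fin n)}
    (h : permLength (σ * adjSwap i) = permLength σ + 1) (f : MvPolynomial (Fin n) K) :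
    Tsigma (σ * adjSwap i) f = Tsigma σ (heckeAt i f) := by
  obtain ⟨w, hw⟩ := exists_reduced σ
  rw [Tsigma_eq hw, Tsigma_eq (w := w ++ [i])]
  · simp [Tword]
  · exact ⟨by simp [hw.1], by simp [hw.2, h]⟩

theorem Tsigma_smul {n : ℕ} (σ : Equiv.Perm (Fin n)) (a : K) (f : MvPolynomial (Fin n) K) :
    Tsigma σ (C a * f) = C a * Tsigma σ f := by
  obtain ⟨w, hw⟩ := exists_reduced σ
  rw [Tsigma_eq hw, Tsigma_eq hw]
  clear hw
  induction w with
  | nil => rfl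
  | cons i w ih =>
    change heckeAt i (Tword w _) = C a * heckeAt i (Tword w f)
    rw [ih]
    exact hecke_smul (by simp [Fin.ext_iff]) _ _

/-! ### Evaluation points and the vanishing theorem -/

theorem kstat_eq {n : ℕ} (ν : Fin n → ℕ) (i : Fin n) :
    kstat ν i = ∑ m, if (m < i ∧ ν i < ν m) ∨ (i < m ∧ ν i ≤ ν m) then 1 else 0 := by
  unfold kstat
  rw [← Set.ncard_union_eq _ (Set.toFinite _) (Set.toFinite _), Finset.sum_boole,
    ← Set.ncard_coe_finset]
  · simp only [Nat.cast_id]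
    congr 1
    ext m
    simp
  · rw [Set.disjoint_left]
    rintro m ⟨h1, _⟩ ⟨h2, _⟩
    exact lt_asymm h1 h2

theorem qq_ne : qq ≠ 0 := by
  unfold qq
  rw [Ne, FaithfulSMul.algebraMap_eq_zero_iff]
  exact X_ne_zero _

theorem tt_ne : tt ≠ 0 := by
  unfold tt
  rw [Ne, FaithfulSMul.algebraMap_eq_zero_iff]
  exact X_ne_zero _

theorem qt_inj {a b k l : ℕ} (h : qq ^ a * tt ^ (-(k : ℤ)) = qq ^ b * tt ^ (-(l : ℤ))) :
    a = b ∧ k = l := by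
  have h1 : qq ^ a * tt ^ l = qq ^ b * tt ^ k := by
    have hk : tt ^ k ≠ 0 := pow_ne_zero _ tt_ne
    have hl : tt ^ l ≠ 0 := pow_ne_zero _ tt_ne
    simp only [zpow_neg, zpow_natCast] at h
    rw [← div_eq_mul_inv, ← div_eq_mul_inv, div_eq_div_iff hk hl] at h
    exact h
  unfold qq tt at h1
  simp only [← map_pow, ← map_mul] at h1
  have h2 := IsFractionRing.injective (MvPolynomial (Fin 2) ℚ) K h1
  simp only [X_pow_eq_monomial, monomial_mul, mul_one] at h2
  have h3 := monomial_left_injective (one_ne_zero) h2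
  have e0 := DFunLike.congr_fun h3 0
  have e1 := DFunLike.congr_fun h3 1
  simp at e0 e1
  exact ⟨e0, e1.symm⟩

theorem evalPt_cons_zero {n : ℕ} (ν : Fin n → ℕ) :
    evalPt (Fin.cons 0 ν : Fin (n + 1) → ℕ) = Fin.cons (tt ^ (-(n : ℤ))) (evalPt ν) := by
  funext i
  refine Fin.cases ?_ (fun i => ?_) i
  · have : kstat (Fin.cons 0 ν : Fin (n + 1) → ℕ) 0 = n := by
      rw [kstat_eq, Fin.sum_univ_succ]
      simp [Fin.succ_pos]
    simp [evalPt, this]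
  · have : kstat (Fin.cons 0 ν : Fin (n + 1) → ℕ) i.succ = kstat ν i := by
      rw [kstat_eq, kstat_eq, Fin.sum_univ_succ]
      simp
    simp [evalPt, this]

/-- The affine rotation of a composition. -/
def rotComp {n : ℕ} (η : Fin (n + 1) → ℕ) : Fin (n + 1) → ℕ :=
  Fin.cons (η (Fin.last n) + 1) (fun i => η (Fin.castSucc i))

theorem evalPt_rot {n : ℕ} (η : Fin (n + 1) → ℕ) :
    evalPt (rotComp η) =
      Fin.cons (qq * evalPt η (Fin.last n)) (fun i => evalPt η (Fin.castSucc i)) := by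
  funext i
  refine Fin.cases ?_ (fun i => ?_) i
  · have : kstat (rotComp η) 0 = kstat η (Fin.last n) := by
      rw [kstat_eq, kstat_eq, Fin.sum_univ_succ, Fin.sum_univ_castSucc]
      simp [rotComp, Fin.succ_pos, Fin.castSucc_lt_last,
        (Fin.castSucc_lt_last _).not_gt]
    simp only [evalPt, this, Fin.cons_zero]
    simp only [rotComp, Fin.cons_zero, pow_succ]
    ring
  · have : kstat (rotComp η) i.succ = kstat η (Fin.castSucc i) := by
      rw [kstat_eq, kstat_eq, Fin.sum_univ_succ, Fin.sum_univ_castSucc, add_comm]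
      simp [rotComp, Fin.succ_pos, Fin.castSucc_lt_last,
        (Fin.castSucc_lt_last _).not_gt]
    simp only [evalPt, this, Fin.cons_succ]
    simp only [rotComp, Fin.cons_succ]

theorem totalDegree_aeval_le' {m n : ℕ} (φ : Fin m → MvPolynomial (Fin n) K)
    (hφ : ∀ k, (φ k).totalDegree ≤ 1) (f : MvPolynomial (Fin m) K) :
    (aeval φ f).totalDegree ≤ f.totalDegree := by
  rw [aeval_def, eval₂_eq]
  apply totalDegree_finsetSum_le
  intro d hd
  refine (totalDegree_mul _ _).trans ?_
  have h1 : (algebraMap K (MvPolynomial (Fin n) K) (coeff d f)).totalDegree = 0 :=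
    totalDegree_C _
  rw [h1, zero_add]
  refine (totalDegree_finsetProd _ _).trans ?_
  refine le_trans ?_ (le_totalDegree hd)
  unfold Finsupp.sum
  apply Finset.sum_le_sum
  intro k _
  refine (totalDegree_pow _ _).trans ?_
  have := Nat.mul_le_mul_left (d k) (hφ k)
  simpa using this

theorem X_sub_C_totalDegree {n : ℕ} (c : K) (i : Fin n) :
    1 ≤ (X i - C c : MvPolynomial (Fin n) K).totalDegree := by
  have : (Finsupp.single i 1 : Fin n →₀ ℕ) ∈ (X i - C c : MvPolynomial (Fin n) K).support := by
    rw [mem_support_iff, coeff_sub, coeff_X, coeff_C]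
    rw [if_pos rfl, if_neg]
    · simp
    · intro h
      have := DFunLike.congr_fun h i
      simp at this
  have := le_totalDegree this
  simpa using this

theorem restrict_dvd {n : ℕ} (c : K) (f : MvPolynomial (Fin (n + 1)) K) :
    ∃ g, f - rename Fin.succ
      (aeval (Fin.cons (C c) X : Fin (n + 1) → MvPolynomial (Fin n) K) f) = (X 0 - C c) * g := by
  induction f using MvPolynomial.induction_on with
  | C a => exact ⟨0, by simp [algebraMap_eq]⟩
  | add p q hp hq =>
    obtain ⟨g, hg⟩ := hp
    obtain ⟨h, hh⟩ := hq
    refine ⟨g + h, ?_⟩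
    rw [map_add, map_add, mul_add, ← hg, ← hh]; ring
  | mul_X p k hp =>
    obtain ⟨g, hg⟩ := hp
    have hk : ∃ e : MvPolynomial (Fin (n + 1)) K, X k - rename Fin.succ
        ((Fin.cons (C c) X : Fin (n + 1) → MvPolynomial (Fin n) K) k) = (X 0 - C c) * e := by
      refine Fin.cases ⟨1, by simp⟩ (fun k => ⟨0, by simp⟩) k
    obtain ⟨e, he⟩ := hk
    refine ⟨g * X k + rename Fin.succ
      (aeval (Fin.cons (C c) X : Fin (n + 1) → MvPolynomial (Fin n) K) p) * e, ?_⟩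
    rw [map_mul, map_mul, aeval_X]
    linear_combination X k * hg + rename Fin.succ
      (aeval (Fin.cons (C c) X : Fin (n + 1) → MvPolynomial (Fin n) K) p) * he

theorem eval_aeval {m n : ℕ} (φ : Fin m → MvPolynomial (Fin n) K) (x : Fin n → K)
    (f : MvPolynomial (Fin m) K) :
    eval x (aeval φ f) = eval (fun k => eval x (φ k)) f := by
  induction f using MvPolynomial.induction_on with
  | C a => simp [algebraMap_eq]
  | add p q hp hq => rw [map_add, map_add, map_add, hp, hq]
  | mul_X p k hp => rw [map_mul, map_mul, map_mul, hp, aeval_X, eval_X]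

/-- The Knop–Sahi vanishing theorem. -/
theorem vanishing : ∀ (n d : ℕ) (f : MvPolynomial (Fin n) K), f.totalDegree ≤ d →
    (∀ ν : Fin n → ℕ, csize ν ≤ d → eval (evalPt ν) f = 0) → f = 0 := by
  intro n
  induction n with
  | zero =>
    intro d f _ hv
    have h := hv 0 (by simp [csize])
    rw [eq_C_of_isEmpty f] at h ⊢
    rw [eval_C] at h
    rw [h, C_0]
  | succ n ihn =>
    intro d
    induction d using Nat.strong_induction_on with
    | _ d ihd =>
      intro f hd hv
      set c : K := tt ^ (-(n : ℤ)) with hc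
      have hf0 : aeval (Fin.cons (C c) X : Fin (n + 1) → MvPolynomial (Fin n) K) f = 0 := by
        apply ihn d
        · refine (totalDegree_aeval_le' _ ?_ f).trans hd
          intro k
          refine Fin.cases ?_ (fun k => ?_) k
          · simp
          · simp
        · intro ν hν
          rw [eval_aeval]
          have := hv (Fin.cons 0 ν) (by
            unfold csize at *
            rw [Fin.sum_univ_succ]
            simpa using hν)
          rw [evalPt_cons_zero] at this
          rw [← this]
          congr 2
          funext k
          refine Fin.cases ?_ (fun k => ?_) k
          · simp [hc]
          · simp
      obtain ⟨g, hg⟩ := restrict_dvd c f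
      rw [hf0, map_zero, sub_zero] at hg
      by_contra hne
      have hX : (X 0 - C c : MvPolynomial (Fin (n + 1)) K) ≠ 0 := by
        intro h; rw [h, zero_mul] at hg; exact hne hg
      have hgne : g ≠ 0 := by
        intro h; rw [h, mul_zero] at hg; exact hne hg
      have hdeg := totalDegree_mul_of_isDomain hX hgne
      rw [← hg] at hdeg
      have h1 := X_sub_C_totalDegree c (0 : Fin (n + 1))
      set φ : Fin (n + 1) → MvPolynomial (Fin (n + 1)) K :=
        Fin.cons (C qq * X (Fin.last n)) (fun i => X (Fin.castSucc i)) with hφ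
      set ψ : Fin (n + 1) → MvPolynomial (Fin (n + 1)) K :=
        Fin.snoc (fun i => X (Fin.succ i)) (C qq⁻¹ * X 0) with hψ
      have hh : aeval φ g = 0 := by
        apply ihd (d - 1) (by omega)
        · refine (totalDegree_aeval_le' _ ?_ g).trans (by omega)
          intro k
          refine Fin.cases ?_ (fun k => ?_) k
          · simp only [hφ, Fin.cons_zero]
            refine (totalDegree_mul _ _).trans ?_
            rw [totalDegree_C, totalDegree_X]
          · simp [hφ]
        · intro η hη
          rw [eval_aeval]
          have hs : csize (rotComp η) = csize η + 1 := by
            unfold csize rotComp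
            rw [Fin.sum_univ_succ, Fin.sum_univ_castSucc]
            simp only [Fin.cons_zero, Fin.cons_succ]
            ring
          have h2 := hv (rotComp η) (by omega)
          have h3 : (fun k => eval (evalPt η) (φ k)) = evalPt (rotComp η) := by
            rw [evalPt_rot]
            funext k
            refine Fin.cases ?_ (fun k => ?_) k
            · simp [hφ]
            · simp [hφ]
          rw [h3]
          rw [hg, map_mul] at h2
          refine (mul_eq_zero.mp h2).resolve_left ?_
          rw [map_sub, eval_X, eval_C, hc]
          intro h4
          have h5 := sub_eq_zero.mp h4
          unfold evalPt at h5
          have h6 := qt_inj (b := 0) (l := n) (by rw [h5]; simp)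
          simp [rotComp] at h6
      have hinv : aeval ψ (aeval φ g) = g := by
        have : (aeval ψ).comp (aeval φ) = AlgHom.id K (MvPolynomial (Fin (n + 1)) K) := by
          apply algHom_ext
          intro k
          rw [AlgHom.comp_apply, aeval_X, AlgHom.id_apply]
          refine Fin.cases ?_ (fun k => ?_) k
          · simp only [hφ, Fin.cons_zero, map_mul, aeval_X, hψ, Fin.snoc_last, algHom_C,
              algebraMap_eq]
            rw [← mul_assoc, ← C_mul, mul_inv_cancel₀ qq_ne, C_1, one_mul]
          · simp [hφ, hψ]
        exact DFunLike.congr_fun this g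
      rw [hh, map_zero] at hinv
      exact hgne hinv.symm

theorem evalPt_ne {n : ℕ} {ν : Fin n → ℕ} {i j : Fin n} (h : ν i ≠ ν j) :
    evalPt ν i - evalPt ν j ≠ 0 := by
  intro h'
  exact h (qt_inj (sub_eq_zero.mp h')).1

theorem evalPt_eq {n : ℕ} {ν : Fin n → ℕ} {i j : Fin n} (hij : (j : ℕ) = (i : ℕ) + 1)
    (h : ν i = ν j) : tt * evalPt ν i - evalPt ν j = 0 := by
  have hk : kstat ν i = kstat ν j + 1 := by
    rw [kstat_eq, kstat_eq]
    have : (1 : ℕ) = ∑ m : Fin n, if m = j then 1 else 0 := by simp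
    rw [this, ← Finset.sum_add_distrib]
    apply Finset.sum_congr rfl
    intro m _
    rw [h]
    have h0 : m = i → ν m = ν j := by rintro rfl; exact h
    have h0' : m = j → ν m = ν j := by rintro rfl; rfl
    simp only [Fin.lt_def, Fin.ext_iff] at *
    split_ifs <;> omega
  unfold evalPt
  rw [hk, h]
  have : tt * tt ^ (-((kstat ν j + 1 : ℕ) : ℤ)) = tt ^ (-(kstat ν j : ℤ)) := by
    rw [← zpow_one_add₀ tt_ne]
    congr 1
    push_cast
    ring
  rw [← this]
  ring

theorem evalPt_swap {n : ℕ} {ν : Fin n → ℕ} {i j : Fin n} (hij : (j : ℕ) = (i : ℕ) + 1)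
    (h : ν i ≠ ν j) : evalPt (swapEntries i j ν) = evalPt ν ∘ Equiv.swap i j := by
  funext k
  have hk : kstat (swapEntries i j ν) k = kstat ν (Equiv.swap i j k) := by
    rw [kstat_eq, kstat_eq]
    refine Eq.trans ?_ (Equiv.sum_comp (Equiv.swap i j) _)
    apply Finset.sum_congr rfl
    intro m _
    unfold swapEntries
    simp only [Function.comp_apply]
    congr 1
    have hmon : ∀ x y : Fin n, x < y → ¬ (x = i ∧ y = j) →
      Equiv.swap i j x < Equiv.swap i j y := fun x y => swap_lt_swap hij
    have hij' : i < j := by rw [Fin.lt_def]; omega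
    rcases lt_trichotomy m k with hlt | heq | hgt
    · by_cases hc : m = i ∧ k = j
      · obtain ⟨rfl, rfl⟩ := hc
        simp [hij', hij'.not_gt, lt_iff_le_and_ne, h, Ne.symm h]
      · have := hmon _ _ hlt hc
        simp [hlt, hlt.not_gt, this, this.not_gt]
    · subst heq; simp
    · by_cases hc : k = i ∧ m = j
      · obtain ⟨rfl, rfl⟩ := hc
        simp [hij', hij'.not_gt, lt_iff_le_and_ne, h, Ne.symm h]
      · have := hmon _ _ hgt hc
        simp [hgt, hgt.not_gt, this, this.not_gt]
  unfold evalPt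
  simp only [Function.comp_apply]
  rw [hk]
  rfl

theorem csize_swap {n : ℕ} (i j : Fin n) (ν : Fin n → ℕ) :
    csize (swapEntries i j ν) = csize ν :=
  Equiv.sum_comp (Equiv.swap i j) ν

/-- `T_i E*_λ = t E*_λ` when `λ_i = λ_{i+1}`. -/
theorem hecke_Estar {n : ℕ} (l : Fin n → ℕ) {i j : Fin n} (hij : (j : ℕ) = (i : ℕ) + 1)
    (hl : l i = l j) : hecke i j (Estar l) = C tt * Estar l := by
  have hne : i ≠ j := by intro h; rw [h] at hij; omega
  by_cases hE : ∃ f, IsEstar l f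
  swap
  · unfold Estar
    rw [dif_neg hE, mul_zero]
    have := hecke_smul hne 0 (0 : MvPolynomial (Fin n) K)
    simpa using this
  have hS : IsEstar l (Estar l) := by
    unfold Estar
    rw [dif_pos hE]
    exact hE.choose_spec
  generalize Estar l = f at hS
  obtain ⟨hd, _, hv⟩ := hS
  have hspec := exactDiv_spec i j f
  unfold hecke
  generalize exactDiv (f - swapVars i j f) (X i - X j) = h at hspec
  have hz : (C tt * X i - X j) * h = 0 := by
    apply vanishing n (csize l)
    · by_cases hh : h = 0
      · simp [hh]
      have h1 := totalDegree_mul_of_isDomain (X_sub_X_ne hne) hh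
      rw [← hspec] at h1
      have h2 : (f - swapVars i j f).totalDegree ≤ csize l := by
        refine (totalDegree_sub _ _).trans (max_le hd ?_)
        exact (totalDegree_rename_le _ _).trans hd
      have h3 : 1 ≤ (X i - X j : MvPolynomial (Fin n) K).totalDegree := by
        have : (Finsupp.single i 1 : Fin n →₀ ℕ) ∈
            (X i - X j : MvPolynomial (Fin n) K).support := by
          rw [mem_support_iff, coeff_sub, coeff_X, coeff_X, if_pos rfl, if_neg]
          · simp
          · intro h
            exact hne (Finsupp.single_left_injective one_ne_zero h).symm
        simpa using le_totalDegree this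
      have h4 : (C tt * X i - X j : MvPolynomial (Fin n) K).totalDegree ≤ 1 := by
        refine (totalDegree_sub _ _).trans (max_le ((totalDegree_mul _ _).trans ?_) ?_)
        · rw [totalDegree_C, totalDegree_X]
        · rw [totalDegree_X]
      refine (totalDegree_mul _ _).trans ?_
      omega
    · intro ν hν
      rw [map_mul, map_sub, map_mul, eval_C, eval_X, eval_X]
      by_cases hc : ν i = ν j
      · rw [evalPt_eq hij hc, zero_mul]
      · have h1 := hv ν hν (by rintro rfl; exact hc hl)
        have h2 := hv (swapEntries i j ν) (by rw [csize_swap]; exact hν) (by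
          intro he
          apply hc
          have e1 := congrFun he i
          have e2 := congrFun he j
          simp only [swapEntries, Function.comp_apply, Equiv.swap_apply_left,
            Equiv.swap_apply_right] at e1 e2
          omega)
        rw [evalPt_swap hij hc] at h2
        have h3 := congrArg (eval (evalPt ν)) hspec
        unfold swapVars at h3
        rw [map_sub, eval_rename, h1, h2, sub_zero, map_mul, map_sub, eval_X, eval_X] at h3
        have h4 := (mul_eq_zero.mp h3.symm).resolve_left (evalPt_ne hc)
        rw [h4, mul_zero]
  rw [hz, sub_zero]

/-! ### Minimal permutations -/

/-- `σ` is increasing on the level sets of `l`. -/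
def IsBlockInc {n : ℕ} (l : Fin n → ℕ) (σ : Equiv.Perm (Fin n)) : Prop :=
  ∀ a b : Fin n, a < b → l a = l b → σ a < σ b

theorem permAct_apply {n : ℕ} {l μ : Fin n → ℕ} {σ : Equiv.Perm (Fin n)}
    (h : permAct σ l = μ) (a : Fin n) : μ (σ a) = l a := by
  rw [← h]; simp [permAct]

theorem permAct_iff {n : ℕ} {l μ : Fin n → ℕ} {σ : Equiv.Perm (Fin n)} :
    permAct σ l = μ ↔ ∀ a, μ (σ a) = l a := by
  refine ⟨permAct_apply, fun h => ?_⟩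
  funext x
  have := h (σ.symm x)
  rw [Equiv.apply_symm_apply] at this
  rw [this]; rfl

theorem blockInc_lt {n : ℕ} {l μ : Fin n → ℕ} (hl : IsPartition l) {σ : Equiv.Perm (Fin n)}
    (hσ : permAct σ l = μ) (hb : IsBlockInc l σ) {x y : Fin n}
    (h : μ y < μ x ∨ (μ x = μ y ∧ x < y)) : σ.symm x < σ.symm y := by
  have hx := permAct_apply hσ (σ.symm x)
  have hy := permAct_apply hσ (σ.symm y)
  rw [Equiv.apply_symm_apply] at hx hy
  by_contra hc
  rw [not_lt] at hc
  have h1 := hl _ _ hc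
  rcases h with h | ⟨h, h'⟩
  · omega
  · rcases hc.lt_or_eq with h2 | h2
    · have := hb _ _ h2 (by omega)
      simp only [Equiv.apply_symm_apply] at this
      exact lt_asymm this h'
    · exact h'.ne (σ.symm.injective h2).symm

theorem blockInc_unique {n : ℕ} {l μ : Fin n → ℕ} (hl : IsPartition l) {σ τ : Equiv.Perm (Fin n)}
    (hσ : permAct σ l = μ) (hb : IsBlockInc l σ) (hτ : permAct τ l = μ) (hb' : IsBlockInc l τ) :
    σ = τ := by
  have hm : StrictMono (fun a => σ.symm (τ a)) := by
    intro a b hab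
    apply blockInc_lt hl hσ hb
    rw [permAct_apply hτ, permAct_apply hτ]
    rcases (hl _ _ hab.le).lt_or_eq with h | h
    · exact Or.inl h
    · exact Or.inr ⟨h.symm, hb' _ _ hab h.symm⟩
  have := hm.eq_id
  refine Equiv.ext fun a => ?_
  have h2 := congrFun this a
  simp only [id_eq, Equiv.symm_apply_eq] at h2
  exact h2.symm

theorem permLength_mul_swap' {n : ℕ} {i j : Fin n} (hij : (j : ℕ) = (i : ℕ) + 1)
    (σ : Equiv.Perm (Fin n)) (h : σ j < σ i) :
    permLength (σ * Equiv.swap i j) + 1 = permLength σ := by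
  have := permLength_swap_mul' hij σ⁻¹ h
  rw [← permLength_inv (σ * Equiv.swap i j), ← permLength_inv σ, mul_inv_rev, Equiv.swap_inv]
  exact this

theorem blockInc_of_min {n : ℕ} {l μ : Fin n → ℕ} (hl : IsPartition l) {σ : Equiv.Perm (Fin n)}
    (hσ : permAct σ l = μ) (hmin : ∀ τ, permAct τ l = μ → permLength σ ≤ permLength τ) :
    IsBlockInc l σ := by
  have adj : ∀ a b : Fin n, (b : ℕ) = a + 1 → l a = l b → σ a < σ b := by
    intro a b hab hlab
    by_contra hc
    have hne : a ≠ b := by intro h; rw [h] at hab; omega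
    have h1 : σ b < σ a := lt_of_le_of_ne (not_lt.mp hc) (fun h => hne (σ.injective h).symm)
    have h2 := permLength_mul_swap' hab σ h1
    have h3 := hmin (σ * Equiv.swap a b) (by
      rw [permAct_iff] at hσ ⊢
      intro x
      rw [Equiv.Perm.mul_apply, hσ, Equiv.swap_apply_def]
      split_ifs with h h'
      · rw [h, hlab]
      · rw [h', hlab]
      · rfl)
    omega
  intro a b hab
  obtain ⟨a, ha⟩ := a
  obtain ⟨b, hb⟩ := b
  rw [Fin.mk_lt_mk] at hab
  induction b, hab using Nat.le_induction with
  | base => exact adj _ _ rfl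
  | succ b hab ih =>
    intro h
    have hb' : b < n := by omega
    have l1 := hl ⟨a, ha⟩ ⟨b, hb'⟩ (by rw [Fin.mk_le_mk]; omega)
    have l2 := hl ⟨b, hb'⟩ ⟨b + 1, hb⟩ (by rw [Fin.mk_le_mk]; omega)
    exact (ih hb' (by omega)).trans (adj _ _ rfl (by omega))

theorem sigmaMin_spec {n : ℕ} {l μ : Fin n → ℕ} (hl : IsPartition l) (hμ : μ ∈ Sn l) :
    permAct (sigmaMin l μ) l = μ ∧ IsBlockInc l (sigmaMin l μ) := by
  have he : ∃ σ, permAct σ l = μ ∧ ∀ τ, permAct τ l = μ → permLength σ ≤ permLength τ := by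
    obtain ⟨σ, h1, h2⟩ := Set.exists_min_image {σ : Equiv.Perm (Fin n) | permAct σ l = μ}
      permLength (Set.toFinite _) hμ
    exact ⟨σ, h1, h2⟩
  unfold sigmaMin
  rw [dif_pos he]
  exact ⟨he.choose_spec.1, blockInc_of_min hl he.choose_spec.1 he.choose_spec.2⟩

theorem sortDesc_eq {n : ℕ} {l μ : Fin n → ℕ} (hl : IsPartition l) (hμ : μ ∈ Sn l) :
    sortDesc μ = l := by
  have he : ∃ l, IsPartition l ∧ μ ∈ Sn l := ⟨l, hl, hμ⟩
  unfold sortDesc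
  rw [dif_pos he]
  obtain ⟨h1, τ, h2⟩ := he.choose_spec
  generalize he.choose = l' at *
  obtain ⟨σ, h3⟩ := hμ
  have e1 : l' = μ ∘ τ := by funext x; exact (permAct_apply h2 x).symm
  have e2 : l = μ ∘ σ := by funext x; exact (permAct_apply h3 x).symm
  rw [e1, e2]
  apply Tuple.unique_antitone
  · rw [← e1]; exact fun a b hab => h1 a b hab
  · rw [← e2]; exact fun a b hab => hl a b hab

theorem swapEntries_mem {n : ℕ} {l μ : Fin n → ℕ} (hμ : μ ∈ Sn l) (i j : Fin n) :
    swapEntries i j μ ∈ Sn l := by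
  obtain ⟨σ, h⟩ := hμ
  refine ⟨Equiv.swap i j * σ, ?_⟩
  rw [permAct_iff]
  intro a
  simp only [swapEntries, Function.comp_apply, Equiv.Perm.mul_apply, Equiv.swap_apply_self]
  exact permAct_apply h a

theorem sigmaMin_swap {n : ℕ} {l μ : Fin n → ℕ} (hl : IsPartition l) (hμ : μ ∈ Sn l)
    {i j : Fin n} (hij : (j : ℕ) = (i : ℕ) + 1) (h : μ i ≠ μ j) :
    sigmaMin l (swapEntries i j μ) = Equiv.swap i j * sigmaMin l μ := by
  obtain ⟨h1, h2⟩ := sigmaMin_spec hl hμ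
  obtain ⟨h3, h4⟩ := sigmaMin_spec hl (swapEntries_mem hμ i j)
  refine blockInc_unique hl h3 h4 ?_ ?_
  · rw [permAct_iff]
    intro a
    simp only [swapEntries, Function.comp_apply, Equiv.Perm.mul_apply, Equiv.swap_apply_self]
    exact permAct_apply h1 a
  · intro a b hab hlab
    rw [Equiv.Perm.mul_apply, Equiv.Perm.mul_apply]
    refine swap_lt_swap hij (h2 a b hab hlab) ?_
    rintro ⟨e1, e2⟩
    apply h
    rw [← e1, ← e2, permAct_apply h1, permAct_apply h1, hlab]

theorem fstar_step {n : ℕ} {l μ : Fin n → ℕ} (hl : IsPartition l) (hμ : μ ∈ Sn l)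
    {i j : Fin n} (hij : (j : ℕ) = (i : ℕ) + 1) (h : μ j < μ i) :
    hecke i j (fstar μ) = fstar (swapEntries i j μ) := by
  unfold fstar
  rw [sortDesc_eq hl hμ, sortDesc_eq hl (swapEntries_mem hμ i j), sigmaMin_swap hl hμ hij h.ne']
  obtain ⟨h1, h2⟩ := sigmaMin_spec hl hμ
  have hlt := blockInc_lt hl h1 h2 (Or.inl h)
  have hlen := permLength_swap_mul hij _ hlt
  obtain ⟨i, hi⟩ := i
  obtain ⟨j, hj⟩ := j
  simp only at hij
  subst hij
  exact (Tsigma_left ⟨i, hj⟩ hlen _).symm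

theorem fstar_eq {n : ℕ} {l μ : Fin n → ℕ} (hl : IsPartition l) (hμ : μ ∈ Sn l)
    {i j : Fin n} (hij : (j : ℕ) = (i : ℕ) + 1) (h : μ i = μ j) :
    hecke i j (fstar μ) = C tt * fstar μ := by
  unfold fstar
  rw [sortDesc_eq hl hμ]
  obtain ⟨h1, h2⟩ := sigmaMin_spec hl hμ
  generalize sigmaMin l μ = σ at *
  have hij' : i < j := by rw [Fin.lt_def]; omega
  have hlt := blockInc_lt hl h1 h2 (Or.inr ⟨h, hij'⟩)
  have hlen := permLength_swap_mul hij _ hlt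
  have hx := permAct_apply h1 (σ.symm i)
  have hy := permAct_apply h1 (σ.symm j)
  rw [Equiv.apply_symm_apply] at hx hy
  -- the preimages are adjacent
  have hadj : ((σ.symm j : Fin n) : ℕ) = (σ.symm i : Fin n) + 1 := by
    by_contra hne
    have hlt' := Fin.lt_def.mp hlt
    have hc : ((σ.symm i : Fin n) : ℕ) + 1 < n := by omega
    have l1 := hl (σ.symm i) ⟨(σ.symm i : Fin n) + 1, hc⟩ (by rw [Fin.le_def]; simp)
    have l2 := hl ⟨(σ.symm i : Fin n) + 1, hc⟩ (σ.symm j) (by rw [Fin.le_def]; simp only; omega)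
    have b1 := h2 (σ.symm i) ⟨(σ.symm i : Fin n) + 1, hc⟩ (by rw [Fin.lt_def]; simp) (by omega)
    have b2 := h2 ⟨(σ.symm i : Fin n) + 1, hc⟩ (σ.symm j) (by rw [Fin.lt_def]; simp only; omega)
      (by omega)
    rw [Equiv.apply_symm_apply, Fin.lt_def] at b1 b2
    omega
  have hconj : Equiv.swap i j * σ = σ * Equiv.swap (σ.symm i) (σ.symm j) := by
    have := Equiv.mul_swap_eq_swap_mul σ (σ.symm i) (σ.symm j)
    rw [Equiv.apply_symm_apply, Equiv.apply_symm_apply] at this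
    exact this.symm
  have hE := hecke_Estar l hadj (by omega)
  have hlen' := hlen
  rw [hconj] at hlen'
  have hright : Tsigma (σ * Equiv.swap (σ.symm i) (σ.symm j)) (Estar l) =
      Tsigma σ (hecke (σ.symm i) (σ.symm j) (Estar l)) := by
    generalize σ.symm i = a at *
    generalize σ.symm j = b at *
    obtain ⟨a, ha⟩ := a
    obtain ⟨b, hb⟩ := b
    simp only at hadj
    subst hadj
    exact Tsigma_right ⟨a, hb⟩ hlen' _
  have hleft : Tsigma (Equiv.swap i j * σ) (Estar l) = hecke i j (Tsigma σ (Estar l)) := by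
    clear hright hlen' hconj hE hadj hx hy hlt hij' h
    obtain ⟨i, hi⟩ := i
    obtain ⟨j, hj⟩ := j
    simp only at hij
    subst hij
    exact Tsigma_left ⟨i, hj⟩ hlen _
  rw [← hleft, hconj, hright, hE, Tsigma_smul]

/-- action of the Hecke operators on interpolation ASEP polynomials. -/
theorem statement5 (n : ℕ) (l : Fin n → ℕ) (hl : IsPartition l)
    (μ : Fin n → ℕ) (hμ : μ ∈ Sn l) (i j : Fin n) (hij : (j : ℕ) = (i : ℕ) + 1) :
    (μ i > μ j → hecke i j (fstar μ) = fstar (swapEntries i j μ)) ∧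
    (μ i = μ j → hecke i j (fstar μ) = C tt * fstar μ) ∧
    (μ i < μ j →
      hecke i j (fstar μ) = C (tt - 1) * fstar μ + C tt * fstar (swapEntries i j μ)) := by
  have hne : i ≠ j := by intro h; rw [h] at hij; omega
  refine ⟨fun h => fstar_step hl hμ hij h, fun h => fstar_eq hl hμ hij h, fun h => ?_⟩
  have hs : swapEntries i j (swapEntries i j μ) = μ := by
    funext x
    simp [swapEntries]
  have h1 := fstar_step hl (swapEntries_mem hμ i j) hij (by
    simpa [swapEntries] using h)
  rw [hs] at h1
  have h2 := hecke_quad hne (fstar (swapEntries i j μ))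
  rw [h1] at h2
  exact h2
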